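/- arXiv:2301.09197 — 5 statements merged into one kernel-verified Lean document; each statement's English description precedes it below -/
import Mathlib

section
/- For every real β ≥ 1, every integer N ≥ 1 and every real C > 0, with h = h_w(β) = log(e^{4β}/(e^{4β}−1)), one has P_N^{β,h_w}( {φ ∈ Ω_N : |q_{2+}(φ)| ≥ C N} ) ≤ exp( −N( (C/20) e^{−6β} − 4β ) ). -/
open Real Finset
open scoped Classical

noncomputable section

/-- The box `Λ_N = {1,…,N}²` in `ℤ²`. -/
def Lam (N : ℕ) : Finset (ℤ × ℤ) := Finset.Icc (1:ℤ) (N:ℤ) ×ˢ Finset.Icc (1:ℤ) (N:ℤ)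

/-- The four nearest neighbors of a site of `ℤ²`. -/
def nbrs (x : ℤ × ℤ) : Finset (ℤ × ℤ) :=
  {(x.1 + 1, x.2), (x.1 - 1, x.2), (x.1, x.2 + 1), (x.1, x.2 - 1)}

/-- An enlarged box containing all edges touching `Λ_N`. -/
def Box (N : ℕ) : Finset (ℤ × ℤ) := Finset.Icc (0:ℤ) ((N:ℤ)+1) ×ˢ Finset.Icc (0:ℤ) ((N:ℤ)+1)

/-- The SOS Hamiltonian with zero boundary conditions, for fields vanishing outside `Λ_N`:
each edge `{x,y}` with `x ~ y` touching `Λ_N` is counted twice in the double sum (once from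
each endpoint, both endpoints lying in `Box N`), whence the factor `1/2`.  Since the field
vanishes outside `Λ_N`, this equals
`Σ_{{x,y}⊂Λ_N, x~y} |φ(x)−φ(y)| + Σ_{x∈Λ_N, y∉Λ_N, x~y} |φ(x)|`. -/
def Ham (N : ℕ) (φ : ℤ × ℤ → ℤ) : ℝ :=
  (1/2) * ∑ x ∈ Box N, ∑ y ∈ nbrs x, |(φ x : ℝ) - (φ y : ℝ)|

/-- The level set `φ⁻¹(k)` inside `Λ_N`. -/
def levelSet (N : ℕ) (φ : ℤ × ℤ → ℤ) (k : ℤ) : Finset (ℤ × ℤ) :=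
  (Lam N).filter fun x => φ x = k

/-- The configuration space `Ω_N`: nonnegative integer fields vanishing outside `Λ_N`. -/
def Conf (N : ℕ) : Type :=
  {φ : ℤ × ℤ → ℤ // (∀ x, 0 ≤ φ x) ∧ ∀ x ∉ Lam N, φ x = 0}

/-- The Boltzmann weight `exp(−β H_N(φ) + h |φ⁻¹(0)|)`. -/
def weight (N : ℕ) (β h : ℝ) (φ : ℤ × ℤ → ℤ) : ℝ :=
  Real.exp (-β * Ham N φ + h * ((levelSet N φ 0).card : ℝ))

/-- The partition function `Z_N^{β,h}`. -/
def Z (N : ℕ) (β h : ℝ) : ℝ := ∑' φ : Conf N, weight N β h φ.val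

/-- The probability of an event `E ⊆ Ω_N` under `P_N^{β,h}`. -/
def prob (N : ℕ) (β h : ℝ) (E : Set (Conf N)) : ℝ :=
  (∑' φ : Conf N, if φ ∈ E then weight N β h φ.val else 0) / Z N β h

/-- The critical pinning value `h_w(β) = log(e^{4β}/(e^{4β}−1))`. -/
def hw (β : ℝ) : ℝ := Real.log (Real.exp (4*β) / (Real.exp (4*β) - 1))

/-- The set `q_{2+}(φ)` of non-isolated zeros of `φ` in `Λ_N`: sites `x ∈ Λ_N` at height `0`
having a nearest neighbor `y ∈ Λ_N` also at height `0`. -/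
def q2p (N : ℕ) (φ : ℤ × ℤ → ℤ) : Finset (ℤ × ℤ) :=
  (Lam N).filter fun x => φ x = 0 ∧ ∃ y ∈ nbrs x ∩ Lam N, φ y = 0

lemma sum_nbrs (x : ℤ × ℤ) (g : ℤ × ℤ → ℝ) :
    ∑ y ∈ nbrs x, g y =
      g (x + (1, 0)) + (g (x + (-1, 0)) + (g (x + (0, 1)) + g (x + (0, -1)))) := by
  obtain ⟨a, b⟩ := x
  unfold nbrs
  rw [Finset.sum_insert, Finset.sum_insert, Finset.sum_insert, Finset.sum_singleton]
  · simp [sub_eq_add_neg]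
  all_goals
    simp only [Finset.mem_insert, Finset.mem_singleton, Prod.mk.injEq, not_or, not_and]
    omega

/-- The variation of `f` across the edges of direction `v`. -/
def dirEnergy (N : ℕ) (f : ℤ × ℤ → ℤ) (v : ℤ × ℤ) : ℝ :=
  ∑ x ∈ Box N, |(f x : ℝ) - (f (x + v) : ℝ)|

lemma Ham_eq_dirEnergy (N : ℕ) (f : ℤ × ℤ → ℤ) :
    Ham N f = (1/2) * (dirEnergy N f (1, 0) + (dirEnergy N f (-1, 0) +
      (dirEnergy N f (0, 1) + dirEnergy N f (0, -1)))) := by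
  simp only [Ham, dirEnergy, ← Finset.sum_add_distrib]
  congr 1
  refine Finset.sum_congr rfl fun x _ => ?_
  rw [sum_nbrs x fun y => |(f x : ℝ) - (f y : ℝ)|]

lemma Ham_add_sub_le (N : ℕ) (f g k : ℤ × ℤ → ℤ) :
    Ham N (fun x => f x + g x - k x) ≤ Ham N f + Ham N g + Ham N k := by
  simp only [Ham, ← mul_add, ← Finset.sum_add_distrib]
  gcongr with x _ y _
  push_cast
  calc _ = |((f x : ℝ) - f y) + ((g x : ℝ) - g y) - ((k x : ℝ) - k y)| := by
        congr 1; ring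
    _ ≤ |((f x : ℝ) - f y) + ((g x : ℝ) - g y)| + |(k x : ℝ) - k y| := abs_sub _ _
    _ ≤ _ := by gcongr; exact abs_add_le _ _

/-- The integer-valued indicator function of `B`. -/
def ind (B : Finset (ℤ × ℤ)) (x : ℤ × ℤ) : ℤ := if x ∈ B then 1 else 0

lemma Lam_subset_Box (N : ℕ) : Lam N ⊆ Box N := by
  intro x hx
  simp only [Lam, Box, Finset.mem_product, Finset.mem_Icc] at *
  omega

lemma dirEnergy_ind_le {N : ℕ} {B : Finset (ℤ × ℤ)} (hB : B ⊆ Lam N) (v : ℤ × ℤ) :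
    dirEnergy N (ind B) v ≤ 2 * (B.card : ℝ) - 2 * ((B.filter fun x => x + v ∈ B).card : ℝ) := by
  have hBox := hB.trans (Lam_subset_Box N)
  have hpt : ∀ x, |(ind B x : ℝ) - (ind B (x + v) : ℝ)| =
      (if x ∈ B then (1 : ℝ) else 0) + (if x + v ∈ B then (1 : ℝ) else 0)
        - 2 * (if x ∈ B ∧ x + v ∈ B then (1 : ℝ) else 0) := by
    intro x
    by_cases h1 : x ∈ B <;> by_cases h2 : x + v ∈ B <;> norm_num [ind, h1, h2]
  unfold dirEnergy
  simp only [hpt, Finset.sum_sub_distrib, Finset.sum_add_distrib, ← Finset.mul_sum,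
    Finset.sum_boole]
  have e1 : (Box N).filter (fun x => x ∈ B) = B := by
    ext x; simp only [Finset.mem_filter]; exact ⟨fun h => h.2, fun h => ⟨hBox h, h⟩⟩
  have e2 : (Box N).filter (fun x => x ∈ B ∧ x + v ∈ B) = B.filter fun x => x + v ∈ B := by
    ext x; simp only [Finset.mem_filter]; exact ⟨fun h => h.2, fun h => ⟨hBox h.1, h⟩⟩
  have e3 : ((Box N).filter fun x => x + v ∈ B).card ≤ B.card :=
    Finset.card_le_card_of_injOn (fun x => x + v)
      (fun x hx => by simpa using (Finset.mem_filter.1 hx).2)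
      (fun x _ y _ h => by simpa using h)
  have e3' : (((Box N).filter fun x => x + v ∈ B).card : ℝ) ≤ B.card := by exact_mod_cast e3
  rw [e1, e2]
  linarith

lemma card_filter_add_neg (B : Finset (ℤ × ℤ)) (v : ℤ × ℤ) :
    (B.filter fun x => x + v ∈ B).card ≤ (B.filter fun x => x + -v ∈ B).card := by
  refine Finset.card_le_card_of_injOn (fun x => x + v) (fun x hx => ?_)
    (fun x _ y _ h => by simpa using h)
  have := Finset.mem_filter.1 hx
  simp [this.1, this.2]

/-- The two positive coordinate directions of `ℤ²`. -/
def unitDir (i : Bool) : ℤ × ℤ := if i then (1, 0) else (0, 1)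

lemma Ham_ind_le {N : ℕ} {B : Finset (ℤ × ℤ)} (hB : B ⊆ Lam N) (i : Bool) :
    Ham N (ind B) ≤ 4 * (B.card : ℝ)
      - 2 * ((B.filter fun x => x + unitDir i ∈ B).card : ℝ) := by
  have h1 := dirEnergy_ind_le hB (1, 0)
  have h2 := dirEnergy_ind_le hB (-1, 0)
  have h3 := dirEnergy_ind_le hB (0, 1)
  have h4 := dirEnergy_ind_le hB (0, -1)
  have c := card_filter_add_neg B (unitDir i)
  have c' : ((B.filter fun x => x + unitDir i ∈ B).card : ℝ)
      ≤ (B.filter fun x => x + -unitDir i ∈ B).card := by exact_mod_cast c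
  have p1 : (0 : ℝ) ≤ ((B.filter fun x => x + (1, 0) ∈ B).card : ℝ) := by positivity
  have p2 : (0 : ℝ) ≤ ((B.filter fun x => x + (-1, 0) ∈ B).card : ℝ) := by positivity
  have p3 : (0 : ℝ) ≤ ((B.filter fun x => x + (0, 1) ∈ B).card : ℝ) := by positivity
  have p4 : (0 : ℝ) ≤ ((B.filter fun x => x + (0, -1) ∈ B).card : ℝ) := by positivity
  rw [Ham_eq_dirEnergy]
  cases i <;> simp only [unitDir, if_true, Bool.false_eq_true, if_false, Prod.neg_mk, neg_zero] at * <;>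
    linarith

lemma card_Lam (N : ℕ) : (Lam N).card = N * N := by
  simp [Lam]

lemma card_Lam_shift (N : ℕ) (hN : 1 ≤ N) (i : Bool) :
    (N : ℝ) * (N - 1) ≤ (((Lam N).filter fun x => x + unitDir i ∈ Lam N).card : ℝ) := by
  have key : ∃ S ⊆ (Lam N).filter (fun x => x + unitDir i ∈ Lam N), S.card = N * (N - 1) := by
    cases i
    · refine ⟨Finset.Icc (1:ℤ) N ×ˢ Finset.Icc (1:ℤ) ((N:ℤ) - 1), ?_, ?_⟩
      · intro x hx
        simp only [Lam, unitDir, Bool.false_eq_true, if_false, Finset.mem_filter,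
          Finset.mem_product, Finset.mem_Icc, Prod.fst_add, Prod.snd_add] at *
        omega
      · rw [Finset.card_product, Int.card_Icc, Int.card_Icc]
        congr 1 <;> omega
    · refine ⟨Finset.Icc (1:ℤ) ((N:ℤ) - 1) ×ˢ Finset.Icc (1:ℤ) N, ?_, ?_⟩
      · intro x hx
        simp only [Lam, unitDir, if_true, Finset.mem_filter,
          Finset.mem_product, Finset.mem_Icc, Prod.fst_add, Prod.snd_add] at *
        omega
      · rw [Finset.card_product, Int.card_Icc, Int.card_Icc, mul_comm]
        congr 1 <;> omega
  obtain ⟨S, hS, hc⟩ := key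
  have h := Finset.card_le_card hS
  rw [hc] at h
  have h' : ((N * (N - 1) : ℕ) : ℝ)
      ≤ (((Lam N).filter fun x => x + unitDir i ∈ Lam N).card : ℝ) := by exact_mod_cast h
  rwa [Nat.cast_mul, Nat.cast_sub hN, Nat.cast_one] at h'

lemma Ham_ind_Lam_le (N : ℕ) (hN : 1 ≤ N) : Ham N (ind (Lam N)) ≤ 4 * (N : ℝ) := by
  have h1 := dirEnergy_ind_le (Finset.Subset.refl (Lam N)) (1, 0)
  have h2 := dirEnergy_ind_le (Finset.Subset.refl (Lam N)) (-1, 0)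
  have h3 := dirEnergy_ind_le (Finset.Subset.refl (Lam N)) (0, 1)
  have h4 := dirEnergy_ind_le (Finset.Subset.refl (Lam N)) (0, -1)
  have c1 : (((Lam N).filter fun x => x + (1, 0) ∈ Lam N).card : ℝ)
      ≤ ((Lam N).filter fun x => x + (-1, 0) ∈ Lam N).card := by
    have := card_filter_add_neg (Lam N) (1, 0)
    simp only [Prod.neg_mk, neg_zero] at this
    exact_mod_cast this
  have c2 : (((Lam N).filter fun x => x + (0, 1) ∈ Lam N).card : ℝ)
      ≤ ((Lam N).filter fun x => x + (0, -1) ∈ Lam N).card := by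
    have := card_filter_add_neg (Lam N) (0, 1)
    simp only [Prod.neg_mk, neg_zero] at this
    exact_mod_cast this
  have d1 := card_Lam_shift N hN true
  have d2 := card_Lam_shift N hN false
  simp only [unitDir, if_true, Bool.false_eq_true, if_false] at d1 d2
  have hL : ((Lam N).card : ℝ) = N * N := by exact_mod_cast card_Lam N
  rw [hL] at h1 h2 h3 h4
  rw [Ham_eq_dirEnergy]
  linarith

lemma sum_powerset_pow_superset {α : Type*} [DecidableEq α] {A V : Finset α} (hV : V ⊆ A) (a : ℝ) :
    ∑ B ∈ A.powerset, (if V ⊆ B then a ^ B.card else 0)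
      = a ^ V.card * (1 + a) ^ (A.card - V.card) := by
  have h := Finset.prod_add (fun _ : α => a) (fun x => if x ∈ V then (0 : ℝ) else 1) A
  have hL : ∏ x ∈ A, (a + if x ∈ V then (0 : ℝ) else 1)
      = a ^ V.card * (1 + a) ^ (A.card - V.card) := by
    rw [← Finset.prod_sdiff hV, mul_comm, ← Finset.card_sdiff_of_subset hV]
    congr 1
    · rw [Finset.prod_congr rfl (g := fun _ => a)]
      · simp
      · intro x hx; simp [hx]
    · rw [Finset.prod_congr rfl (g := fun _ => 1 + a)]
      · simp
      · intro x hx; simp [(Finset.mem_sdiff.1 hx).2, add_comm]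
  rw [← hL, h]
  refine Finset.sum_congr rfl fun B hB => ?_
  split_ifs with hVB
  · rw [Finset.prod_const, Finset.prod_eq_one, mul_one]
    intro x hx
    rw [if_neg]
    exact fun hx' => (Finset.mem_sdiff.1 hx).2 (hVB hx')
  · obtain ⟨x, hxV, hxB⟩ := Finset.not_subset.1 hVB
    rw [Finset.prod_eq_zero (i := x) (Finset.mem_sdiff.2 ⟨hV hxV, hxB⟩) (by simp [hxV]), mul_zero]

lemma sum_powerset_pow_matching {α : Type*} [DecidableEq α] {A D : Finset α} {τ : α → α}
    (hτ : Function.Injective τ) (hD : D ⊆ A) (hD' : D.image τ ⊆ A)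
    (hdisj : Disjoint D (D.image τ)) {a t : ℝ} (ha : 0 ≤ a) :
    ∑ B ∈ A.powerset, a ^ B.card * (1 + t) ^ (D.filter fun x => x ∈ B ∧ τ x ∈ B).card
      = (1 + a) ^ A.card * (1 + t * (a / (1 + a)) ^ 2) ^ D.card := by
  have hpow : ∀ (s : ℝ) (S : Finset α), (1 + s) ^ S.card = ∑ M ∈ S.powerset, s ^ M.card := by
    intro s S
    have := Finset.prod_one_add (f := fun _ : α => s) S
    simpa using this
  have hstep : ∀ B ∈ A.powerset,
      a ^ B.card * (1 + t) ^ (D.filter fun x => x ∈ B ∧ τ x ∈ B).card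
      = ∑ M ∈ D.powerset, t ^ M.card * (if M ∪ M.image τ ⊆ B then a ^ B.card else 0) := by
    intro B _
    rw [hpow, Finset.mul_sum]
    have : (D.filter fun x => x ∈ B ∧ τ x ∈ B).powerset
        = D.powerset.filter fun M => M ∪ M.image τ ⊆ B := by
      ext M
      simp only [Finset.mem_powerset, Finset.mem_filter, Finset.union_subset_iff]
      simp only [Finset.subset_iff, Finset.mem_filter, Finset.mem_image]
      constructor
      · intro h
        refine ⟨fun x hx => (h hx).1, fun x hx => (h hx).2.1, ?_⟩
        rintro _ ⟨x, hx, rfl⟩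
        exact (h hx).2.2
      · rintro ⟨h1, h2, h3⟩ x hx
        exact ⟨h1 hx, h2 hx, h3 ⟨x, hx, rfl⟩⟩
    rw [this, Finset.sum_filter]
    refine Finset.sum_congr rfl fun M _ => ?_
    split_ifs <;> ring
  rw [Finset.sum_congr rfl hstep, Finset.sum_comm, hpow _ D, Finset.mul_sum]
  refine Finset.sum_congr rfl fun M hM => ?_
  have hM := Finset.mem_powerset.1 hM
  have himg := Finset.image_subset_image (f := τ) hM
  have hV : M ∪ M.image τ ⊆ A := Finset.union_subset (hM.trans hD) (himg.trans hD')
  have hcard : (M ∪ M.image τ).card = 2 * M.card := by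
    rw [Finset.card_union_of_disjoint (Finset.disjoint_of_subset_left hM
      (Finset.disjoint_of_subset_right himg hdisj)), Finset.card_image_of_injective _ hτ]
    ring
  have hle := Finset.card_le_card hV
  rw [← Finset.mul_sum, sum_powerset_pow_superset hV, hcard]
  rw [hcard] at hle
  have h1 : (1 + a) ≠ 0 := by positivity
  have hsplit : (1 + a) ^ A.card = (1 + a) ^ (A.card - 2 * M.card) * (1 + a) ^ (2 * M.card) := by
    rw [← pow_add]; congr 1; omega
  rw [hsplit, mul_pow, ← pow_mul, div_pow]
  field_simp

/-- The coordinate of `x` in the direction `unitDir i`. -/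
def coord (i : Bool) (x : ℤ × ℤ) : ℤ := if i then x.1 else x.2

/-- Base points of the edges of direction `unitDir i` and of parity class `r` with both endpoints
at height `0`. -/
def zeroEdges (N : ℕ) (φ : ℤ × ℤ → ℤ) (i r : Bool) : Finset (ℤ × ℤ) :=
  (Lam N).filter fun x => φ x = 0 ∧ x + unitDir i ∈ Lam N ∧ φ (x + unitDir i) = 0 ∧
    (Even (coord i x) ↔ r = true)

lemma zeroEdges_subset (N : ℕ) (φ : ℤ × ℤ → ℤ) (i r : Bool) :
    zeroEdges N φ i r ⊆ levelSet N φ 0 := by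
  intro x hx
  simp only [zeroEdges, levelSet, Finset.mem_filter] at *
  exact ⟨hx.1, hx.2.1⟩

lemma image_zeroEdges_subset (N : ℕ) (φ : ℤ × ℤ → ℤ) (i r : Bool) :
    (zeroEdges N φ i r).image (· + unitDir i) ⊆ levelSet N φ 0 := by
  intro y hy
  obtain ⟨x, hx, rfl⟩ := Finset.mem_image.1 hy
  simp only [zeroEdges, levelSet, Finset.mem_filter] at *
  exact ⟨hx.2.2.1, hx.2.2.2.1⟩

lemma coord_add_unitDir (i : Bool) (x : ℤ × ℤ) : coord i (x + unitDir i) = coord i x + 1 := by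
  cases i <;> simp [coord, unitDir]

lemma disjoint_zeroEdges (N : ℕ) (φ : ℤ × ℤ → ℤ) (i r : Bool) :
    Disjoint (zeroEdges N φ i r) ((zeroEdges N φ i r).image (· + unitDir i)) := by
  rw [Finset.disjoint_left]
  intro y hy hy'
  obtain ⟨x, hx, rfl⟩ := Finset.mem_image.1 hy'
  have h1 := (Finset.mem_filter.1 hx).2.2.2.2
  have h2 := (Finset.mem_filter.1 hy).2.2.2.2
  rw [coord_add_unitDir, Int.even_add_one] at h2
  tauto

lemma q2p_subset (N : ℕ) (φ : ℤ × ℤ → ℤ) :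
    q2p N φ ⊆ (Finset.univ : Finset (Bool × Bool)).biUnion fun c =>
      zeroEdges N φ c.1 c.2 ∪ (zeroEdges N φ c.1 c.2).image (· + unitDir c.1) := by
  have base : ∀ x i, x ∈ Lam N → φ x = 0 → x + unitDir i ∈ Lam N → φ (x + unitDir i) = 0 →
      x ∈ zeroEdges N φ i (decide (Even (coord i x))) := by
    intro x i h1 h2 h3 h4
    simp [zeroEdges, h1, h2, h3, h4]
  intro x hx
  simp only [q2p, Finset.mem_filter, Finset.mem_inter] at hx
  obtain ⟨hxL, hx0, y, ⟨hyn, hyL⟩, hy0⟩ := hx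
  have hy : ∃ i, y = x + unitDir i ∨ x = y + unitDir i := by
    obtain ⟨a, b⟩ := x
    simp only [nbrs, Finset.mem_insert, Finset.mem_singleton] at hyn
    rcases hyn with rfl | rfl | rfl | rfl
    · exact ⟨true, by simp [unitDir]⟩
    · exact ⟨true, by simp [unitDir]⟩
    · exact ⟨false, by simp [unitDir]⟩
    · exact ⟨false, by simp [unitDir]⟩
  simp only [Finset.mem_biUnion, Finset.mem_union, Finset.mem_image]
  obtain ⟨i, rfl | rfl⟩ := hy
  · exact ⟨(i, _), Finset.mem_univ _, Or.inl (base x i hxL hx0 hyL hy0)⟩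
  · exact ⟨(i, _), Finset.mem_univ _, Or.inr ⟨y, base y i hyL hy0 hxL hx0, rfl⟩⟩

lemma exists_card_zeroEdges (N : ℕ) (φ : ℤ × ℤ → ℤ) :
    ∃ i r, (q2p N φ).card ≤ 8 * (zeroEdges N φ i r).card := by
  by_contra! hcon
  have h := (Finset.card_le_card (q2p_subset N φ)).trans Finset.card_biUnion_le
  have hle : ∀ i r, (zeroEdges N φ i r ∪ (zeroEdges N φ i r).image (· + unitDir i)).card
      ≤ 2 * (zeroEdges N φ i r).card := by
    intro i r
    refine (Finset.card_union_le _ _).trans ?_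
    have := Finset.card_image_le (s := zeroEdges N φ i r) (f := (· + unitDir i))
    omega
  rw [Fintype.sum_prod_type] at h
  simp only [Fintype.sum_bool] at h
  have a1 := hle true true
  have a2 := hle true false
  have a3 := hle false true
  have a4 := hle false false
  have b1 := hcon true true
  have b2 := hcon true false
  have b3 := hcon false true
  have b4 := hcon false false
  omega

/-- The field `φ` raised by one in `Λ_N`, except on the set `B` of zeros of `φ`. -/
def lift {N : ℕ} (φ : Conf N) {B : Finset (ℤ × ℤ)} (hB : B ⊆ levelSet N φ.val 0) : Conf N :=
  ⟨fun x => φ.val x + ind (Lam N) x - ind B x, by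
    constructor
    · intro x
      have h0 := φ.property.1 x
      by_cases hx : x ∈ B
      · simp [ind, hx, (Finset.mem_filter.1 (hB hx)).1, h0]
      · simp only [ind, hx, if_false]
        split_ifs <;> omega
    · intro x hx
      have hxB : x ∉ B := fun h => hx (Finset.mem_filter.1 (hB h)).1
      simp [ind, hx, hxB, φ.property.2 x hx]⟩

lemma levelSet_lift {N : ℕ} (φ : Conf N) {B : Finset (ℤ × ℤ)} (hB : B ⊆ levelSet N φ.val 0) :
    levelSet N (lift φ hB).val 0 = B := by
  ext x
  have h0 := φ.property.1 x
  rw [levelSet, Finset.mem_filter]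
  change x ∈ Lam N ∧ φ.val x + ind (Lam N) x - ind B x = 0 ↔ x ∈ B
  unfold ind
  constructor
  · rintro ⟨h1, h2⟩
    by_contra hx
    simp only [h1, hx, if_true, if_false] at h2
    omega
  · intro hx
    have := Finset.mem_filter.1 (hB hx)
    simp [hx, this.1, this.2]

lemma lift_injective {N : ℕ} {φ φ' : Conf N} {B B' : Finset (ℤ × ℤ)}
    (hB : B ⊆ levelSet N φ.val 0) (hB' : B' ⊆ levelSet N φ'.val 0)
    (h : lift φ hB = lift φ' hB') : φ = φ' ∧ B = B' := by
  have hBB : B = B' := by rw [← levelSet_lift φ hB, ← levelSet_lift φ' hB', h]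
  subst hBB
  refine ⟨Subtype.ext (funext fun x => ?_), rfl⟩
  have := congrFun (congrArg Subtype.val h) x
  simp only [lift] at this
  linarith

lemma Ham_lift_le {N : ℕ} (hN : 1 ≤ N) (φ : Conf N) {B : Finset (ℤ × ℤ)}
    (hB : B ⊆ levelSet N φ.val 0) (i r : Bool) :
    Ham N (lift φ hB).val ≤ Ham N φ.val + 4 * (N : ℝ) + (4 * (B.card : ℝ)
      - 2 * (((zeroEdges N φ.val i r).filter fun x => x ∈ B ∧ x + unitDir i ∈ B).card : ℝ)) := by
  have hBL : B ⊆ Lam N := hB.trans (Finset.filter_subset _ _)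
  have h1 := Ham_add_sub_le N φ.val (ind (Lam N)) (ind B)
  have h2 := Ham_ind_Lam_le N hN
  have h3 := Ham_ind_le hBL i
  have h4 : ((zeroEdges N φ.val i r).filter fun x => x ∈ B ∧ x + unitDir i ∈ B).card
      ≤ (B.filter fun x => x + unitDir i ∈ B).card := by
    refine Finset.card_le_card fun x hx => ?_
    simp only [Finset.mem_filter] at *
    exact hx.2
  have h4' : (((zeroEdges N φ.val i r).filter fun x => x ∈ B ∧ x + unitDir i ∈ B).card : ℝ)
      ≤ ((B.filter fun x => x + unitDir i ∈ B).card : ℝ) := by exact_mod_cast h4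
  have h5 : Ham N (lift φ hB).val = Ham N fun x => φ.val x + ind (Lam N) x - ind B x := rfl
  linarith

lemma exp_hw {β : ℝ} (hβ : 0 < β) : Real.exp (hw β) = 1 + Real.exp (-(4*β)) * Real.exp (hw β) := by
  have h1 : 1 < Real.exp (4*β) := Real.one_lt_exp_iff.2 (by linarith)
  have h2 : 0 < Real.exp (4*β) - 1 := by linarith
  rw [hw, Real.exp_log (by positivity), Real.exp_neg]
  field_simp
  ring

lemma weight_mul_le_sum_lift {N : ℕ} (hN : 1 ≤ N) {β : ℝ} (hβ : 0 < β) (φ : Conf N) (i r : Bool) :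
    weight N β (hw β) φ.val *
        (1 + (Real.exp (-(6*β)) - Real.exp (-(8*β)))) ^ (zeroEdges N φ.val i r).card
      ≤ Real.exp (4*β*N) * ∑ B ∈ (levelSet N φ.val 0).powerset.attach,
          weight N β (hw β) (lift φ (Finset.mem_powerset.1 B.2)).val := by
  set a := Real.exp (-(4*β)) * Real.exp (hw β) with ha
  set t := Real.exp (2*β) - 1 with ht
  set D := zeroEdges N φ.val i r
  have hp := exp_hw hβ
  rw [← ha] at hp
  have ha0 : 0 ≤ a := by positivity
  have hq : a / (1 + a) = Real.exp (-(4*β)) := by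
    rw [← hp, ha]; field_simp
  have ht' : t * (a / (1 + a)) ^ 2 = Real.exp (-(6*β)) - Real.exp (-(8*β)) := by
    rw [hq, ← Real.exp_nat_mul, ht, sub_mul, ← Real.exp_add, one_mul]
    congr 2 <;> push_cast <;> ring
  have hsum := sum_powerset_pow_matching (add_left_injective (unitDir i))
    (zeroEdges_subset N φ.val i r) (image_zeroEdges_subset N φ.val i r)
    (disjoint_zeroEdges N φ.val i r) (t := t) ha0
  rw [ht', ← hp] at hsum
  have hterm : ∀ B (hB : B ⊆ levelSet N φ.val 0),
      Real.exp (-β * Ham N φ.val) *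
        (a ^ B.card * (1 + t) ^ (D.filter fun x => x ∈ B ∧ x + unitDir i ∈ B).card)
      ≤ Real.exp (4*β*N) * weight N β (hw β) (lift φ hB).val := by
    intro B hB
    have h1t : 1 + t = Real.exp (2*β) := by rw [ht]; ring
    rw [weight, levelSet_lift, h1t, ha, ← Real.exp_add, ← Real.exp_nat_mul, ← Real.exp_nat_mul,
      ← Real.exp_add, ← Real.exp_add, ← Real.exp_add]
    refine Real.exp_le_exp.2 ?_
    have := mul_le_mul_of_nonneg_left (Ham_lift_le hN φ hB i r) hβ.le
    linarith
  calc _ = Real.exp (-β * Ham N φ.val) * (Real.exp (hw β) ^ (levelSet N φ.val 0).card *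
          (1 + (Real.exp (-(6*β)) - Real.exp (-(8*β)))) ^ D.card) := by
        rw [weight, Real.exp_add, ← Real.exp_nat_mul, mul_comm (hw β), mul_assoc]
    _ = ∑ B ∈ (levelSet N φ.val 0).powerset, Real.exp (-β * Ham N φ.val) *
        (a ^ B.card * (1 + t) ^ (D.filter fun x => x ∈ B ∧ x + unitDir i ∈ B).card) := by
        rw [← hsum, Finset.mul_sum]
    _ ≤ _ := by
        rw [← Finset.sum_attach, Finset.mul_sum]
        exact Finset.sum_le_sum fun B _ => hterm B.1 _

lemma exp_le_one_add_sub {β : ℝ} (hβ : 1 ≤ β) :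
    Real.exp ((2/5) * Real.exp (-(6*β))) ≤ 1 + (Real.exp (-(6*β)) - Real.exp (-(8*β))) := by
  have h8 : Real.exp (-(8*β)) = Real.exp (-(6*β)) * Real.exp (-(2*β)) := by
    rw [← Real.exp_add]; congr 1; ring
  have h2 : Real.exp (-(2*β)) ≤ 1/5 := by
    have h5 : (5:ℝ) ≤ Real.exp (2*β) := by
      have e1 : Real.exp 1 ≤ Real.exp β := Real.exp_le_exp.2 hβ
      have e2 := Real.exp_one_gt_d9
      have e3 : Real.exp (2*β) = Real.exp β * Real.exp β := by
        rw [← Real.exp_add]; congr 1; ring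
      nlinarith
    rw [Real.exp_neg, ← one_div]
    exact one_div_le_one_div_of_le (by norm_num) h5
  have h6 : Real.exp (-(6*β)) ≤ 1 := Real.exp_le_one_iff.2 (by linarith)
  set y := Real.exp (-(6*β))
  have hy : 0 < y := Real.exp_pos _
  have hb : Real.exp ((2/5) * y) ≤ 1 / (1 - (2/5) * y) := by
    have := Real.add_one_le_exp (-((2/5) * y))
    rw [le_div_iff₀ (by linarith)]
    calc _ ≤ Real.exp ((2/5) * y) * Real.exp (-((2/5) * y)) := by gcongr; linarith
      _ = 1 := by rw [← Real.exp_add]; simp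
  have hc : 1 / (1 - (2/5) * y) ≤ 1 + (4/5) * y := by
    rw [div_le_iff₀ (by linarith)]
    nlinarith
  rw [h8]
  nlinarith

lemma weight_le_sum_lift {N : ℕ} (hN : 1 ≤ N) {β C : ℝ} (hβ : 1 ≤ β) (φ : Conf N)
    (hφ : C * (N : ℝ) ≤ ((q2p N φ.val).card : ℝ)) :
    weight N β (hw β) φ.val
      ≤ Real.exp (-((N:ℝ) * ((C/20) * Real.exp (-6*β) - 4*β))) *
        ∑ B ∈ (levelSet N φ.val 0).powerset.attach,
          weight N β (hw β) (lift φ (Finset.mem_powerset.1 B.2)).val := by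
  obtain ⟨i, r, hcard⟩ := exists_card_zeroEdges N φ.val
  have hcard' : ((q2p N φ.val).card : ℝ) ≤ 8 * ((zeroEdges N φ.val i r).card : ℝ) := by
    exact_mod_cast hcard
  have h := weight_mul_le_sum_lift hN (by linarith : 0 < β) φ i r
  set y := Real.exp (-(6*β)) with hy
  have hy0 : 0 < y := Real.exp_pos _
  have hgain : Real.exp (N * ((C/20) * y))
      ≤ (1 + (y - Real.exp (-(8*β)))) ^ (zeroEdges N φ.val i r).card := by
    calc _ ≤ Real.exp ((2/5) * y) ^ (zeroEdges N φ.val i r).card := by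
          rw [← Real.exp_nat_mul]
          refine Real.exp_le_exp.2 ?_
          nlinarith
      _ ≤ _ := pow_le_pow_left₀ (Real.exp_pos _).le (exp_le_one_add_sub hβ) _
  have hw0 : 0 ≤ weight N β (hw β) φ.val := (Real.exp_pos _).le
  have hexp : Real.exp (-((N:ℝ) * ((C/20) * Real.exp (-6*β) - 4*β)))
      = Real.exp (-(N * ((C/20) * y))) * Real.exp (4*β*N) := by
    rw [← Real.exp_add, hy, neg_mul]; congr 1; ring
  rw [hexp, mul_assoc]
  refine le_trans ?_ (mul_le_mul_of_nonneg_left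
    ((mul_le_mul_of_nonneg_left hgain hw0).trans h) (Real.exp_pos _).le)
  rw [mul_left_comm, ← Real.exp_add]
  simp

lemma sum_sum_lift_le_Z {N : ℕ} {β h : ℝ}
    (hs : Summable fun φ : Conf N => weight N β h φ.val) (S : Finset (Conf N)) :
    ∑ φ ∈ S, ∑ B ∈ (levelSet N φ.val 0).powerset.attach,
      weight N β h (lift φ (Finset.mem_powerset.1 B.2)).val ≤ Z N β h := by
  rw [Finset.sum_sigma']
  rw [← Finset.sum_image (s := S.sigma fun φ => (levelSet N φ.val 0).powerset.attach)
    (f := fun ψ : Conf N => weight N β h ψ.val)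
    (g := fun p => lift p.1 (Finset.mem_powerset.1 p.2.2))]
  · exact hs.sum_le_tsum _ fun _ _ => (Real.exp_pos _).le
  · rintro ⟨φ, B⟩ _ ⟨φ', B'⟩ _ heq
    obtain ⟨rfl, hB⟩ := lift_injective _ _ heq
    obtain rfl := Subtype.ext hB
    rfl

/-- Theorem 1.3: upper bound on the number of non-isolated zeros at criticality `h = h_w(β)`. -/
theorem non_isolated_zeros_at_criticality (β C : ℝ) (N : ℕ)
    (hβ : 1 ≤ β) (hC : 0 < C) (hN : 1 ≤ N) :
    prob N β (hw β) {φ : Conf N | C * (N:ℝ) ≤ ((q2p N φ.val).card : ℝ)} ≤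
      Real.exp (-((N:ℝ) * ((C/20) * Real.exp (-6*β) - 4*β))) := by
  have hexp := Real.exp_pos (-((N:ℝ) * ((C/20) * Real.exp (-6*β) - 4*β)))
  have hZ0 : 0 ≤ Z N β (hw β) := tsum_nonneg fun _ => (Real.exp_pos _).le
  by_cases hs : Summable fun φ : Conf N => weight N β (hw β) φ.val
  · refine div_le_of_le_mul₀ hZ0 hexp.le (Real.tsum_le_of_sum_le ?_ fun S => ?_)
    · intro φ
      change 0 ≤ ite _ _ _
      split_ifs
      · exact (Real.exp_pos _).le
      · exact le_rfl
    · refine le_trans ?_ (mul_le_mul_of_nonneg_left (sum_sum_lift_le_Z hs S) hexp.le)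
      rw [Finset.mul_sum]
      refine Finset.sum_le_sum fun φ _ => ?_
      split_ifs with hφ
      · exact weight_le_sum_lift hN hβ φ hφ
      · exact mul_nonneg hexp.le (Finset.sum_nonneg fun _ _ => (Real.exp_pos _).le)
  · rw [prob, Z, tsum_eq_zero_of_not_summable hs, div_zero]
    exact hexp.le
end
end

section
/- For every real β > 0, all reals h₁, h₂ with 0 ≤ h₁ ≤ h₂, and every integer N ≥ 1, the measure P_N^{β,h₁} stochastically dominates P_N^{β,h₂}: for every bounded function f : Ω_N → ℝ that is increasing with respect to the pointwise partial order (φ ≤ ψ meaning φ(x) ≤ ψ(x) for all x ∈ Λ_N), one has E_N^{β,h₂}[f] ≤ E_N^{β,h₁}[f], where E_N^{β,h} denotes expectation with respect to P_N^{β,h}. -/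
open Real Finset
open scoped Classical

noncomputable section

theorem abs_min_sub_min_add_abs_max_sub_max_le (a b c d : ℝ) :
    |min a b - min c d| + |max a b - max c d| ≤ |a - c| + |b - d| := by
  rcases le_total a b with h | h <;> rcases le_total c d with h' | h' <;>
    simp only [min_eq_left, min_eq_right, max_eq_left, max_eq_right, h, h', le_refl]
  · rcases abs_cases (a - d) with h1 | h1 <;> rcases abs_cases (b - c) with h2 | h2 <;>
      rcases abs_cases (a - c) with h3 | h3 <;> rcases abs_cases (b - d) with h4 | h4 <;> linarith
  · rcases abs_cases (b - c) with h1 | h1 <;> rcases abs_cases (a - d) with h2 | h2 <;>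
      rcases abs_cases (a - c) with h3 | h3 <;> rcases abs_cases (b - d) with h4 | h4 <;> linarith
  · linarith

theorem summable_prod_apply {ι α : Type*} [Fintype ι] {g : α → ℝ} (hg0 : ∀ a, 0 ≤ g a)
    (hg : Summable g) : Summable fun φ : ι → α => ∏ i, g (φ i) := by
  refine summable_of_sum_le (c := ∏ _i : ι, ∑' a, g a)
    (fun φ => Finset.prod_nonneg fun i _ => hg0 _) fun u => ?_
  calc ∑ φ ∈ u, ∏ i, g (φ i)
      ≤ ∑ φ ∈ Fintype.piFinset fun i => u.image fun φ : ι → α => φ i, ∏ i, g (φ i) := by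
        refine Finset.sum_le_sum_of_subset_of_nonneg (fun φ hφ => ?_)
          fun φ _ _ => Finset.prod_nonneg fun i _ => hg0 _
        exact Fintype.mem_piFinset.2 fun i => Finset.mem_image_of_mem _ hφ
    _ = ∏ i, ∑ a ∈ u.image fun φ : ι → α => φ i, g a := (Finset.prod_univ_sum _ _).symm
    _ ≤ ∏ _i : ι, ∑' a, g a :=
        Finset.prod_le_prod (fun i _ => Finset.sum_nonneg fun a _ => hg0 a)
          fun i _ => hg.sum_le_tsum _ fun a _ => hg0 a

/-- The Holley inequality for summable weights on a possibly infinite distributive lattice. -/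
theorem tsum_mul_tsum_le_of_holley {α : Type*} [DistribLattice α] {u v f : α → ℝ}
    (hu0 : 0 ≤ u) (hv0 : 0 ≤ v) (hf0 : 0 ≤ f) (hf : Monotone f)
    (hu : Summable u) (hv : Summable v)
    (hfu : Summable fun a => f a * u a) (hfv : Summable fun a => f a * v a)
    (h : ∀ a b, u a * v b ≤ u (a ⊓ b) * v (a ⊔ b)) :
    (∑' a, f a * u a) * ∑' a, v a ≤ (∑' a, u a) * ∑' a, f a * v a := by
  have hfu0 : ∀ a, 0 ≤ f a * u a := fun a => mul_nonneg (hf0 a) (hu0 a)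
  have hfv0 : ∀ a, 0 ≤ f a * v a := fun a => mul_nonneg (hf0 a) (hv0 a)
  have key : ∀ s : Finset α, (∑ a ∈ s, f a * u a) * ∑ a ∈ s, v a ≤
      (∑' a, u a) * ∑' a, f a * v a := fun s => by
    refine (four_functions_theorem (fun a => f a * u a) v u (fun a => f a * v a)
      hfu0 hv0 hu0 hfv0 (fun a b => ?_) s s).trans ?_
    · calc f a * u a * v b = f a * (u a * v b) := mul_assoc _ _ _
        _ ≤ f (a ⊔ b) * (u (a ⊓ b) * v (a ⊔ b)) :=
          mul_le_mul (hf le_sup_left) (h a b) (mul_nonneg (hu0 _) (hv0 _)) (hf0 _)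
        _ = u (a ⊓ b) * (f (a ⊔ b) * v (a ⊔ b)) := mul_left_comm _ _ _
    · exact mul_le_mul (hu.sum_le_tsum _ fun a _ => hu0 a) (hfv.sum_le_tsum _ fun a _ => hfv0 a)
        (Finset.sum_nonneg fun a _ => hfv0 a) (tsum_nonneg hu0)
  exact le_of_tendsto' (Filter.Tendsto.mul hfu.hasSum hv.hasSum) key

namespace Conf

variable {N : ℕ}

instance : LE (Conf N) := ⟨fun φ ψ => φ.val ≤ ψ.val⟩

instance : LT (Conf N) := ⟨fun φ ψ => φ.val < ψ.val⟩

instance : Max (Conf N) :=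
  ⟨fun φ ψ => ⟨φ.val ⊔ ψ.val, fun x => le_sup_of_le_left (φ.2.1 x), fun x hx => by
    simp [φ.2.2 x hx, ψ.2.2 x hx]⟩⟩

instance : Min (Conf N) :=
  ⟨fun φ ψ => ⟨φ.val ⊓ ψ.val, fun x => le_inf (φ.2.1 x) (ψ.2.1 x), fun x hx => by
    simp [φ.2.2 x hx, ψ.2.2 x hx]⟩⟩

instance : DistribLattice (Conf N) :=
  Function.Injective.distribLattice (fun φ : Conf N => φ.val) Subtype.val_injective
    Iff.rfl Iff.rfl (fun _ _ => rfl) (fun _ _ => rfl)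

theorem val_sup (φ ψ : Conf N) : (φ ⊔ ψ).val = φ.val ⊔ ψ.val := rfl

theorem val_inf (φ ψ : Conf N) : (φ ⊓ ψ).val = φ.val ⊓ ψ.val := rfl

end Conf

theorem Ham_inf_add_Ham_sup_le (N : ℕ) (φ ψ : ℤ × ℤ → ℤ) :
    Ham N (φ ⊓ ψ) + Ham N (φ ⊔ ψ) ≤ Ham N φ + Ham N ψ := by
  unfold Ham
  rw [← mul_add, ← mul_add, ← Finset.sum_add_distrib, ← Finset.sum_add_distrib]
  refine mul_le_mul_of_nonneg_left (Finset.sum_le_sum fun x _ => ?_) (by norm_num)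
  rw [← Finset.sum_add_distrib, ← Finset.sum_add_distrib]
  refine Finset.sum_le_sum fun y _ => ?_
  simpa only [Pi.inf_apply, Pi.sup_apply, Int.cast_min, Int.cast_max] using
    abs_min_sub_min_add_abs_max_sub_max_le (φ x : ℝ) (ψ x) (φ y) (ψ y)

theorem levelSet_inf_zero {N : ℕ} (φ ψ : Conf N) :
    levelSet N (φ ⊓ ψ).val 0 = levelSet N φ.val 0 ∪ levelSet N ψ.val 0 := by
  ext x
  have := φ.2.1 x
  have := ψ.2.1 x
  simp only [levelSet, Conf.val_inf, Pi.inf_apply, Finset.mem_filter, Finset.mem_union]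
  grind

theorem levelSet_sup_zero {N : ℕ} (φ ψ : Conf N) :
    levelSet N (φ ⊔ ψ).val 0 = levelSet N φ.val 0 ∩ levelSet N ψ.val 0 := by
  ext x
  have := φ.2.1 x
  have := ψ.2.1 x
  simp only [levelSet, Conf.val_sup, Pi.sup_apply, Finset.mem_filter, Finset.mem_inter]
  grind

theorem weight_mul_weight_le {N : ℕ} {β h₁ h₂ : ℝ} (hβ : 0 ≤ β) (h12 : h₁ ≤ h₂)
    (φ ψ : Conf N) :
    weight N β h₂ φ.val * weight N β h₁ ψ.val ≤
      weight N β h₂ (φ ⊓ ψ).val * weight N β h₁ (φ ⊔ ψ).val := by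
  simp only [weight, ← Real.exp_add]
  rw [Real.exp_le_exp]
  have hH := mul_le_mul_of_nonneg_left (Ham_inf_add_Ham_sup_le N φ.val ψ.val) hβ
  rw [← Conf.val_inf, ← Conf.val_sup] at hH
  have hcard : ((levelSet N (φ ⊓ ψ).val 0).card : ℝ) + (levelSet N (φ ⊔ ψ).val 0).card =
      (levelSet N φ.val 0).card + (levelSet N ψ.val 0).card := by
    rw [levelSet_inf_zero, levelSet_sup_zero]
    exact_mod_cast Finset.card_union_add_card_inter _ _
  have hle : ((levelSet N φ.val 0).card : ℝ) ≤ (levelSet N (φ ⊓ ψ).val 0).card := by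
    rw [levelSet_inf_zero]
    exact_mod_cast Finset.card_le_card Finset.subset_union_left
  linear_combination hH + mul_nonneg (sub_nonneg.2 h12) (sub_nonneg.2 hle) - h₁ * hcard

theorem abs_sub_le_two_mul_Ham {N : ℕ} (φ : ℤ × ℤ → ℤ) {x y : ℤ × ℤ} (hx : x ∈ Box N)
    (hy : y ∈ nbrs x) : |(φ x : ℝ) - φ y| ≤ 2 * Ham N φ := by
  have h1 : |(φ x : ℝ) - φ y| ≤ ∑ y ∈ nbrs x, |(φ x : ℝ) - φ y| :=
    Finset.single_le_sum (f := fun y => |(φ x : ℝ) - φ y|) (fun _ _ => abs_nonneg _) hy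
  have h2 : ∑ y ∈ nbrs x, |(φ x : ℝ) - φ y| ≤ ∑ x ∈ Box N, ∑ y ∈ nbrs x, |(φ x : ℝ) - φ y| :=
    Finset.single_le_sum (f := fun x => ∑ y ∈ nbrs x, |(φ x : ℝ) - φ y|)
      (fun _ _ => Finset.sum_nonneg fun _ _ => abs_nonneg _) hx
  unfold Ham
  linarith

theorem Ham_nonneg (N : ℕ) (φ : ℤ × ℤ → ℤ) : 0 ≤ Ham N φ :=
  mul_nonneg (by norm_num)
    (Finset.sum_nonneg fun _ _ => Finset.sum_nonneg fun _ _ => abs_nonneg _)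

theorem apply_le_of_add_eq {N : ℕ} (φ : Conf N) {j : ℤ} (hj : 0 ≤ j) (hj' : j ≤ N + 1) (k : ℕ) :
    ∀ i : ℤ, 0 ≤ i → i + k = N + 1 → (φ.val (i, j) : ℝ) ≤ k * (2 * Ham N φ.val) := by
  induction k with
  | zero =>
    intro i _ hik
    rw [φ.2.2 (i, j) (by simp [Lam]; omega)]
    simp
  | succ k ih =>
    intro i hi hik
    push_cast at hik ⊢
    have h1 := ih (i + 1) (by omega) (by omega)
    have h2 := (le_abs_self _).trans (abs_sub_le_two_mul_Ham (N := N) φ.val (x := (i, j))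
      (y := (i + 1, j)) (by simp [Box]; omega) (by simp [nbrs]))
    linarith

theorem apply_le_mul_Ham {N : ℕ} (φ : Conf N) {x : ℤ × ℤ} (hx : x ∈ Lam N) :
    (φ.val x : ℝ) ≤ (2 * (N + 1)) * Ham N φ.val := by
  obtain ⟨i, j⟩ := x
  simp only [Lam, Finset.mem_product, Finset.mem_Icc] at hx
  refine (apply_le_of_add_eq φ (by omega) (by omega) (N + 1 - i).toNat i (by omega)
    (by omega)).trans ?_
  have h : (((N + 1 - i).toNat : ℕ) : ℝ) ≤ N + 1 := by
    exact_mod_cast (by omega : (N + 1 - i).toNat ≤ N + 1)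
  have h' := mul_le_mul_of_nonneg_right h (Ham_nonneg N φ.val)
  linarith

theorem sum_apply_le_mul_Ham {N : ℕ} (φ : Conf N) :
    ∑ x ∈ Lam N, (φ.val x : ℝ) ≤ ((Lam N).card * (2 * (N + 1))) * Ham N φ.val := by
  refine (Finset.sum_le_card_nsmul _ _ _ fun x hx => apply_le_mul_Ham φ hx).trans_eq ?_
  rw [nsmul_eq_mul, ← mul_assoc]

theorem summable_weight (N : ℕ) {β h : ℝ} (hβ : 0 < β) (hh : 0 ≤ h) :
    Summable fun φ : Conf N => weight N β h φ.val := by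
  set K : ℝ := (Lam N).card * (2 * (N + 1)) + 1 with hK
  have hK0 : 0 < K := by positivity
  have hgeo : Summable fun n : ℕ => Real.exp (-(β / K) * n) := by
    simpa only [mul_comm] using Real.summable_exp_nat_mul_iff.2 (neg_lt_zero.2 (div_pos hβ hK0))
  have hprod := summable_prod_apply (ι := Lam N) (fun n => (Real.exp_pos _).le) hgeo
  let e : Conf N → (Lam N → ℕ) := fun φ x => (φ.val x).toNat
  have he : Function.Injective e := fun φ ψ hφψ => Subtype.ext <| funext fun x => by
    by_cases hx : x ∈ Lam N
    · have h1 : (φ.val x).toNat = (ψ.val x).toNat := congrFun hφψ ⟨x, hx⟩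
      have h2 := φ.2.1 x
      have h3 := ψ.2.1 x
      omega
    · rw [φ.2.2 x hx, ψ.2.2 x hx]
  refine Summable.of_nonneg_of_le (fun φ => (Real.exp_pos _).le) (fun φ => ?_)
    ((hprod.comp_injective he).mul_left (Real.exp (h * (Lam N).card)))
  have hsum : ∑ x : Lam N, -(β / K) * ((e φ x : ℕ) : ℝ) =
      -(β / K) * ∑ x ∈ Lam N, (φ.val x : ℝ) := by
    rw [← Finset.mul_sum, ← Finset.sum_coe_sort (Lam N)]
    congr 1
    refine Finset.sum_congr rfl fun x _ => ?_
    exact_mod_cast congrArg (Int.cast : ℤ → ℝ) (Int.toNat_of_nonneg (φ.2.1 x))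
  rw [Function.comp_apply, ← Real.exp_sum, hsum, ← Real.exp_add, weight, Real.exp_le_exp]
  have hcard : h * ((levelSet N φ.val 0).card : ℝ) ≤ h * (Lam N).card :=
    mul_le_mul_of_nonneg_left (by exact_mod_cast Finset.card_filter_le _ _) hh
  have hS : ∑ x ∈ Lam N, (φ.val x : ℝ) ≤ K * Ham N φ.val := by
    have := sum_apply_le_mul_Ham φ
    have := Ham_nonneg N φ.val
    rw [hK, add_mul]
    linarith
  have hS' := mul_le_mul_of_nonneg_left hS (div_pos hβ hK0).le
  rw [← mul_assoc, div_mul_cancel₀ β hK0.ne'] at hS'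
  linarith

/-- Lemma 2.1: stochastic domination `P_N^{β,h₂} ⪯ P_N^{β,h₁}` for `0 ≤ h₁ ≤ h₂`:
for every bounded increasing `f : Ω_N → ℝ` one has `E_N^{β,h₂}[f] ≤ E_N^{β,h₁}[f]`. -/
theorem stochastic_domination_pinning (β h₁ h₂ : ℝ) (N : ℕ)
    (hβ : 0 < β) (h1 : 0 ≤ h₁) (h12 : h₁ ≤ h₂) (hN : 1 ≤ N)
    (f : Conf N → ℝ)
    (hbdd : ∃ M : ℝ, ∀ φ : Conf N, |f φ| ≤ M)
    (hmono : ∀ φ ψ : Conf N, (∀ x, φ.val x ≤ ψ.val x) → f φ ≤ f ψ) :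
    (∑' φ : Conf N, f φ * weight N β h₂ φ.val) / Z N β h₂ ≤
      (∑' φ : Conf N, f φ * weight N β h₁ φ.val) / Z N β h₁ := by
  obtain ⟨M, hM⟩ := hbdd
  have hw0 : ∀ (h : ℝ) (φ : Conf N), 0 < weight N β h φ.val := fun h φ => Real.exp_pos _
  have hsum₁ := summable_weight N hβ h1
  have hsum₂ := summable_weight N hβ (h1.trans h12)
  have hfsum : ∀ h : ℝ, (Summable fun φ : Conf N => weight N β h φ.val) →
      Summable fun φ : Conf N => f φ * weight N β h φ.val := fun h hs => by
    refine Summable.of_norm_bounded (hs.mul_left M) fun φ => ?_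
    rw [Real.norm_eq_abs, abs_mul, abs_of_pos (hw0 h φ)]
    exact mul_le_mul_of_nonneg_right (hM φ) (hw0 h φ).le
  have hZ : ∀ h : ℝ, (Summable fun φ : Conf N => weight N β h φ.val) → 0 < Z N β h :=
    fun h hs => hs.tsum_pos (fun φ => (hw0 h φ).le)
      ⟨fun _ => 0, fun _ => le_rfl, fun _ _ => rfl⟩ (hw0 h _)
  have hshift : ∀ h : ℝ, (hs : Summable fun φ : Conf N => weight N β h φ.val) →
      HasSum (fun φ : Conf N => (f φ + M) * weight N β h φ.val)
        ((∑' φ : Conf N, f φ * weight N β h φ.val) + M * Z N β h) := fun h hs => by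
    simp only [add_mul]
    exact (hfsum h hs).hasSum.add (hs.hasSum.mul_left M)
  have key := tsum_mul_tsum_le_of_holley (u := fun φ : Conf N => weight N β h₂ φ.val)
    (v := fun φ : Conf N => weight N β h₁ φ.val) (f := fun φ => f φ + M)
    (fun φ => (hw0 h₂ φ).le) (fun φ => (hw0 h₁ φ).le)
    (fun φ => neg_le_iff_add_nonneg.1 (abs_le.1 (hM φ)).1)
    (fun φ ψ hφψ => add_le_add_left (hmono φ ψ hφψ) M) hsum₂ hsum₁
    (hshift h₂ hsum₂).summable (hshift h₁ hsum₁).summable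
    (weight_mul_weight_le hβ.le h12)
  rw [(hshift h₂ hsum₂).tsum_eq, (hshift h₁ hsum₁).tsum_eq] at key
  change _ * Z N β h₁ ≤ Z N β h₂ * _ at key
  rw [div_le_div_iff₀ (hZ h₂ hsum₂) (hZ h₁ hsum₁)]
  linarith
end
end

section
/- Let β ≥ 1 be real and let h be the real number with e^{−h} = 1 − e^{−4β}. Then e^{−3h} (1 + 3e^{−4β} + e^{−8β} + 2e^{−6β + 2h} + e^{−8β + 3h}) ≥ 1 + e^{−6β}. -/
/-- Lemma 4.1, pattern (2) (three-vertex path): with `e^{−h} = 1 − e^{−4β}` and `β ≥ 1`,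
`e^{−3h}(1 + 3e^{−4β} + e^{−8β} + 2e^{−6β+2h} + e^{−8β+3h}) ≥ 1 + e^{−6β}`. -/
theorem pattern_three_path_bound (β h : ℝ) (hβ : 1 ≤ β)
    (hh : Real.exp (-h) = 1 - Real.exp (-4*β)) :
    1 + Real.exp (-6*β) ≤
      Real.exp (-3*h) * (1 + 3 * Real.exp (-4*β) + Real.exp (-8*β)
        + 2 * Real.exp (-6*β + 2*h) + Real.exp (-8*β + 3*h)) := by
  set t := Real.exp (-2*β) with ht
  have ht0 : 0 < t := Real.exp_pos _
  have ht1 : t ≤ 1/5 := by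
    have hle : t ≤ (Real.exp 2)⁻¹ := by
      rw [← Real.exp_neg]
      exact Real.exp_le_exp.mpr (by linarith)
    have h2 : (5:ℝ) ≤ Real.exp 2 := by
      have h1 := Real.exp_one_gt_d9
      have hsq : Real.exp 2 = Real.exp 1 * Real.exp 1 := by
        rw [← Real.exp_add]; norm_num
      rw [hsq]; nlinarith
    calc t ≤ (Real.exp 2)⁻¹ := hle
      _ ≤ 5⁻¹ := inv_anti₀ (by norm_num) h2
      _ = 1/5 := by norm_num
  have e4 : Real.exp (-4*β) = t^2 := by
    rw [ht, ← Real.exp_nat_mul]; congr 1; push_cast; ring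
  have e6 : Real.exp (-6*β) = t^3 := by
    rw [ht, ← Real.exp_nat_mul]; congr 1; push_cast; ring
  have e8 : Real.exp (-8*β) = t^4 := by
    rw [ht, ← Real.exp_nat_mul]; congr 1; push_cast; ring
  rw [e4] at hh
  have e3h : Real.exp (-3*h) = (1 - t^2)^3 := by
    rw [← hh, ← Real.exp_nat_mul]; congr 1; push_cast; ring
  have m1 : Real.exp (-3*h) * Real.exp (-6*β + 2*h) = t^3 * (1 - t^2) := by
    rw [← hh, ← e6, ← Real.exp_add, ← Real.exp_add]; congr 1; ring
  have m2 : Real.exp (-3*h) * Real.exp (-8*β + 3*h) = t^4 := by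
    rw [← e8, ← Real.exp_add]; congr 1; ring
  have expand : Real.exp (-3*h) * (1 + 3 * Real.exp (-4*β) + Real.exp (-8*β)
        + 2 * Real.exp (-6*β + 2*h) + Real.exp (-8*β + 3*h))
      = (1 - t^2)^3 * (1 + 3 * t^2 + t^4) + 2 * (t^3 * (1 - t^2)) + t^4 := by
    rw [e4, e8]
    linear_combination (1 + 3 * t^2 + t^4) * e3h + 2 * m1 + m2
  rw [expand, e6]
  have h7 : t^7 ≤ t^3 := pow_le_pow_of_le_one ht0.le (by linarith) (by norm_num)
  have hq : 0 ≤ 1 - 4*t - 2*t^2 + 5*t^3 - t^7 := by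
    nlinarith [pow_pos ht0 3]
  nlinarith [mul_nonneg (pow_pos ht0 3).le hq]
end

section
/- Let β ≥ 1 be real and let h be the real number with e^{−h} = 1 − e^{−4β}. Then e^{−4h} (1 + 4e^{−4β} + 3e^{−6β + 2h}) ≥ 1 + e^{−6β}. -/
/-- The polynomial inequality behind `pattern_T_bound`, in the variable `t = e^{-2β}`. -/
lemma one_add_cube_le_of_le_one_seventh {t : ℝ} (ht : 0 ≤ t) (ht' : t ≤ 1 / 7) :
    1 + t ^ 3 ≤ (1 - t ^ 2) ^ 4 * (1 + 4 * t ^ 2) + 3 * t ^ 3 * (1 - t ^ 2) ^ 2 := by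
  have h2 : t ^ 2 ≤ (1 / 7) ^ 2 := by gcongr
  have h5 : 0 ≤ t ^ 3 * (20 - 15 * t ^ 2) := mul_nonneg (by positivity) (by linarith)
  have key : 0 ≤ t ^ 3 * (2 - 10 * t - 6 * t ^ 2 + t ^ 3 * (20 - 15 * t ^ 2)
      + 3 * t ^ 4 + 4 * t ^ 7) := by
    have h4 : 0 ≤ t ^ 4 := by positivity
    have h7 : 0 ≤ t ^ 7 := by positivity
    exact mul_nonneg (by positivity) (by linarith)
  linear_combination key

/-- Lemma 4.1, pattern (3) (four-vertex T-shape): with `e^{−h} = 1 − e^{−4β}` and `β ≥ 1`,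
`e^{−4h}(1 + 4e^{−4β} + 3e^{−6β+2h}) ≥ 1 + e^{−6β}`. -/
theorem pattern_T_bound (β h : ℝ) (hβ : 1 ≤ β)
    (hh : Real.exp (-h) = 1 - Real.exp (-4*β)) :
    1 + Real.exp (-6*β) ≤
      Real.exp (-4*h) * (1 + 4 * Real.exp (-4*β) + 3 * Real.exp (-6*β + 2*h)) := by
  have e4 : Real.exp (-4 * β) = Real.exp (-2 * β) ^ 2 := by
    rw [← Real.exp_nat_mul]; congr 1; push_cast; ring
  have e6 : Real.exp (-6 * β) = Real.exp (-2 * β) ^ 3 := by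
    rw [← Real.exp_nat_mul]; congr 1; push_cast; ring
  have eh4 : Real.exp (-4 * h) = Real.exp (-h) ^ 4 := by
    rw [← Real.exp_nat_mul]; congr 1; push_cast; ring
  have eh2 : Real.exp (-4 * h) * Real.exp (-6 * β + 2 * h)
      = Real.exp (-2 * β) ^ 3 * Real.exp (-h) ^ 2 := by
    rw [← Real.exp_nat_mul, ← Real.exp_nat_mul, ← Real.exp_add, ← Real.exp_add]
    congr 1; push_cast; ring
  have ht : Real.exp (-2 * β) ≤ 1 / 7 := by
    have h7 : (7 : ℝ) ≤ Real.exp (2 * β) := by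
      have h1 : Real.exp 1 ^ 2 ≤ Real.exp (2 * β) := by
        rw [← Real.exp_nat_mul]
        exact Real.exp_le_exp.mpr (by push_cast; linarith)
      nlinarith [Real.exp_one_gt_d9]
    rw [neg_mul, Real.exp_neg, ← one_div]
    exact one_div_le_one_div_of_le (by norm_num) h7
  have key := one_add_cube_le_of_le_one_seventh (Real.exp_pos (-2 * β)).le ht
  rw [e4] at hh
  rw [hh] at eh4 eh2
  rw [e4, e6]
  linear_combination key - (1 + 4 * Real.exp (-2 * β) ^ 2) * eh4 - 3 * eh2
end

section
/- Let β ≥ 1 be real and let h be the real number with e^{−h} = 1 − e^{−4β}. Then e^{−5h} (1 + 5e^{−4β} + 4e^{−6β + 2h}) ≥ 1 + e^{−6β}. -/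
/-- The polynomial form of the bound, in the variable `x = e^{−2β}`. -/
lemma one_add_cube_le_cross_polynomial {x : ℝ} (hx0 : 0 ≤ x) (hx : x ≤ 1 / 7) :
    1 + x ^ 3 ≤ (1 - x ^ 2) ^ 5 * (1 + 5 * x ^ 2) + 4 * x ^ 3 * (1 - x ^ 2) ^ 3 := by
  have ha0 : 0 ≤ x ^ 2 := by positivity
  have ha : x ^ 2 ≤ 1 / 49 := by nlinarith
  have h5 : 1 - 15 * (x ^ 2) ^ 2 ≤ (1 - x ^ 2) ^ 5 * (1 + 5 * x ^ 2) := by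
    generalize x ^ 2 = a at ha0 ha
    have key : 0 ≤ a ^ 3 * ((40 - 45 * a) + a ^ 2 * (24 - 5 * a)) :=
      mul_nonneg (by positivity)
        (add_nonneg (by linarith) (mul_nonneg (by positivity) (by linarith)))
    linear_combination key
  have h3 : 1 - 3 * x ^ 2 ≤ (1 - x ^ 2) ^ 3 := by
    have key : 0 ≤ (x ^ 2) ^ 2 * (3 - x ^ 2) := mul_nonneg (by positivity) (by linarith)
    linear_combination key
  have h3' := mul_le_mul_of_nonneg_left h3 (by positivity : 0 ≤ 4 * x ^ 3)
  have key : 0 ≤ x ^ 3 * (3 - 15 * x - 12 * x ^ 2) := mul_nonneg (by positivity) (by linarith)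
  linear_combination key + h5 + h3'

/-- Lemma 4.1, pattern (4) (five-vertex cross): with `e^{−h} = 1 − e^{−4β}` and `β ≥ 1`,
`e^{−5h}(1 + 5e^{−4β} + 4e^{−6β+2h}) ≥ 1 + e^{−6β}`. -/
theorem pattern_cross_bound (β h : ℝ) (hβ : 1 ≤ β)
    (hh : Real.exp (-h) = 1 - Real.exp (-4*β)) :
    1 + Real.exp (-6*β) ≤
      Real.exp (-5*h) * (1 + 5 * Real.exp (-4*β) + 4 * Real.exp (-6*β + 2*h)) := by
  have e4 : Real.exp (-4 * β) = Real.exp (-2 * β) ^ 2 := by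
    rw [← Real.exp_nat_mul]; congr 1; push_cast; ring
  have e6 : Real.exp (-6 * β) = Real.exp (-2 * β) ^ 3 := by
    rw [← Real.exp_nat_mul]; congr 1; push_cast; ring
  have e5h : Real.exp (-5 * h) = Real.exp (-h) ^ 5 := by
    rw [← Real.exp_nat_mul]; congr 1; push_cast; ring
  have e3h : Real.exp (-5 * h) * Real.exp (-6 * β + 2 * h) =
      Real.exp (-6 * β) * Real.exp (-h) ^ 3 := by
    rw [← Real.exp_nat_mul, ← Real.exp_add, ← Real.exp_add]; congr 1; push_cast; ring
  have hx : Real.exp (-2 * β) ≤ 1 / 7 := by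
    have h7 : (7 : ℝ) ≤ Real.exp 2 := by
      have h1 := Real.exp_one_gt_d9
      have h2 : Real.exp 2 = Real.exp 1 * Real.exp 1 := by rw [← Real.exp_add]; norm_num
      nlinarith
    calc Real.exp (-2 * β) ≤ Real.exp (-2) := Real.exp_le_exp.mpr (by linarith)
      _ = 1 / Real.exp 2 := by rw [Real.exp_neg, one_div]
      _ ≤ 1 / 7 := one_div_le_one_div_of_le (by norm_num) h7
  have main := one_add_cube_le_cross_polynomial (Real.exp_pos (-2 * β)).le hx
  rw [mul_add, mul_left_comm, e3h, e5h, hh, e4, e6]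
  linarith
end
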